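/- arXiv:2509.10363 — 5 statements merged into one kernel-verified Lean document; each statement's English description precedes it below -/
import Mathlib

section
/- Let Ω be a nonempty compact metric space with a finite Borel measure μ and N ≥ 1. Let ρ_k, ρ_{k+1} : Ω → [0,∞) be bounded measurable importance densities and x_k, x_{k+1} ∈ Ω^N configurations. Suppose the update strictly decreases the coverage energy, i.e. J_{ρ_k}(x_{k+1}) < J_{ρ_k}(x_k), and that the importance update satisfies sup_{q∈Ω} |ρ_{k+1}(q) − ρ_k(q)| < (J_{ρ_k}(x_k) − J_{ρ_k}(x_{k+1})) / C_Ω, where 0 < C_Ω < ∞. Then the combined two-step update satisfies J_{ρ_{k+1}}(x_{k+1}) < J_{ρ_k}(x_k). -/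
open MeasureTheory

/-- Voronoi cell of the `i`-th generator of the configuration `x`. -/
def voronoiCell {Ω : Type*} [MetricSpace Ω] {N : ℕ} (x : Fin N → Ω) (i : Fin N) : Set Ω :=
  {q | ∀ j, dist q (x i) ≤ dist q (x j)}

/-- Coverage energy `J_ρ(x)` of a configuration `x` with importance density `ρ`. -/
noncomputable def coverageEnergy {Ω : Type*} [MetricSpace Ω] [MeasurableSpace Ω] {N : ℕ}
    (μ : Measure Ω) (ρ : Ω → ℝ) (x : Fin N → Ω) : ℝ :=
  ∑ i, ∫ q in voronoiCell x i, ρ q * (dist q (x i)) ^ 2 ∂μ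

/-- The geometric constant `C_Ω = sup_{x ∈ Ω^N} Σ_i ∫_{V_i(x)} dist(q,x_i)² dμ`. -/
noncomputable def geomConst {Ω : Type*} [MetricSpace Ω] [MeasurableSpace Ω]
    (μ : Measure Ω) (N : ℕ) : ℝ :=
  ⨆ x : Fin N → Ω, ∑ i, ∫ q in voronoiCell x i, (dist q (x i)) ^ 2 ∂μ

theorem integrable_mul_dist_sq {Ω : Type*} [MetricSpace Ω] [MeasurableSpace Ω] [BorelSpace Ω]
    [CompactSpace Ω] (μ : Measure Ω) [IsFiniteMeasure μ] {ρ : Ω → ℝ} (hm : Measurable ρ)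
    (hn : ∀ q, 0 ≤ ρ q) (hb : ∃ M, ∀ q, ρ q ≤ M) (a : Ω) :
    Integrable (fun q => ρ q * dist q a ^ 2) μ := by
  obtain ⟨M, hM⟩ := hb
  have hd : Integrable (fun q => dist q a ^ 2) μ :=
    Continuous.integrable_of_hasCompactSupport (by fun_prop) (HasCompactSupport.of_compactSpace _)
  refine hd.bdd_mul (c := M) hm.aestronglyMeasurable (ae_of_all _ fun q => ?_)
  rw [Real.norm_of_nonneg (hn q)]
  exact hM q

/-- Changing the density by at most `ε` changes the energy by at most `ε` times the
unweighted energy. -/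
theorem coverageEnergy_le_add {Ω : Type*} [MetricSpace Ω] [MeasurableSpace Ω] [BorelSpace Ω]
    [CompactSpace Ω] (μ : Measure Ω) [IsFiniteMeasure μ] {N : ℕ} {ρ ρ' : Ω → ℝ}
    (hm : Measurable ρ) (hm' : Measurable ρ') (hn : ∀ q, 0 ≤ ρ q) (hn' : ∀ q, 0 ≤ ρ' q)
    (hb : ∃ M, ∀ q, ρ q ≤ M) (hb' : ∃ M, ∀ q, ρ' q ≤ M) {ε : ℝ}
    (hε : ∀ q, ρ' q ≤ ρ q + ε) (x : Fin N → Ω) :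
    coverageEnergy μ ρ' x ≤ coverageEnergy μ ρ x +
      ε * ∑ i, ∫ q in voronoiCell x i, dist q (x i) ^ 2 ∂μ := by
  simp only [coverageEnergy]
  rw [Finset.mul_sum, ← Finset.sum_add_distrib]
  refine Finset.sum_le_sum fun i _ => ?_
  have hd : Integrable (fun q => dist q (x i) ^ 2) μ :=
    Continuous.integrable_of_hasCompactSupport (by fun_prop) (HasCompactSupport.of_compactSpace _)
  have hρ := (integrable_mul_dist_sq μ hm hn hb (x i)).integrableOn (s := voronoiCell x i)
  have hρ' := (integrable_mul_dist_sq μ hm' hn' hb' (x i)).integrableOn (s := voronoiCell x i)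
  have hdε := (hd.const_mul ε).integrableOn (s := voronoiCell x i)
  rw [← integral_const_mul, ← integral_add hρ hdε]
  refine integral_mono hρ' (hρ.add hdε) fun q => ?_
  change ρ' q * dist q (x i) ^ 2 ≤ ρ q * dist q (x i) ^ 2 + ε * dist q (x i) ^ 2
  rw [← add_mul]
  exact mul_le_mul_of_nonneg_right (hε q) (sq_nonneg _)

/-- **Monotonic decrease of model-relative coverage.** If the Lloyd step strictly decreases
the coverage energy and the importance update is small enough compared to the achieved
descent (relative to `C_Ω`), then the combined two-step update strictly decreases the
model-relative coverage energy. -/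
theorem monotone_decrease_model_relative_coverage
    {Ω : Type*} [MetricSpace Ω] [MeasurableSpace Ω] [BorelSpace Ω]
    [CompactSpace Ω] [Nonempty Ω]
    (μ : Measure Ω) [IsFiniteMeasure μ]
    {N : ℕ} (hN : 1 ≤ N)
    (ρk ρk1 : Ω → ℝ)
    (hmk : Measurable ρk) (hmk1 : Measurable ρk1)
    (hnk : ∀ q, 0 ≤ ρk q) (hnk1 : ∀ q, 0 ≤ ρk1 q)
    (hbk : ∃ M, ∀ q, ρk q ≤ M) (hbk1 : ∃ M, ∀ q, ρk1 q ≤ M)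
    (xk xk1 : Fin N → Ω)
    (hCpos : 0 < geomConst μ N)
    (hCfin : BddAbove (Set.range fun x : Fin N → Ω =>
      ∑ i, ∫ q in voronoiCell x i, (dist q (x i)) ^ 2 ∂μ))
    (hLloyd : coverageEnergy μ ρk xk1 < coverageEnergy μ ρk xk)
    (hupdate : (⨆ q, |ρk1 q - ρk q|) <
      (coverageEnergy μ ρk xk - coverageEnergy μ ρk xk1) / geomConst μ N) :
    coverageEnergy μ ρk1 xk1 < coverageEnergy μ ρk xk := by
  have hbdd : BddAbove (Set.range fun q => |ρk1 q - ρk q|) := by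
    obtain ⟨M, hM⟩ := hbk
    obtain ⟨M', hM'⟩ := hbk1
    refine ⟨M + M', ?_⟩
    rintro _ ⟨q, rfl⟩
    exact abs_le.mpr ⟨by linarith [hM q, hM' q, hnk q, hnk1 q],
      by linarith [hM q, hM' q, hnk q, hnk1 q]⟩
  have hle : ∀ q, ρk1 q ≤ ρk q + ⨆ q, |ρk1 q - ρk q| := fun q => by
    linarith [le_abs_self (ρk1 q - ρk q), le_ciSup hbdd q]
  have hstep := coverageEnergy_le_add μ hmk hmk1 hnk hnk1 hbk hbk1 hle xk1
  have hgeom := mul_le_mul_of_nonneg_left (le_ciSup hCfin xk1)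
    (Real.iSup_nonneg fun q => abs_nonneg (ρk1 q - ρk q))
  have hlt := (lt_div_iff₀ hCpos).mp hupdate
  simp only [geomConst] at hlt
  linarith
end

section
/- Let x* ∈ ℝ² (the Euclidean plane), α > 0, r ∈ (0,1), and N ≥ 1. Let x_1,…,x_N : [0,∞) → ℝ² be continuously differentiable sensor trajectories satisfying the continuous Lloyd dynamics x_i'(t) = −α·(x_i(t) − c_i(t)) for continuous centroid trajectories c_i : [0,∞) → ℝ². Define the minimal distance m(t) = min_{1≤i≤N} ‖x_i(t) − x*‖. Assume that for every t ≥ 0 and every index i attaining the minimum m(t), the centroid satisfies ‖c_i(t) − x*‖ ≤ r·m(t). Then m(t) ≤ e^{α(r−1)t}·m(0) for all t ≥ 0; in particular m(t) → 0 as t → ∞. -/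
open scoped Topology

/-- Minimal distance from the sensors `x i` (at time `t`) to the source `xstar`. -/
noncomputable def minDist {N : ℕ} (x : Fin N → ℝ → EuclideanSpace ℝ (Fin 2))
    (xstar : EuclideanSpace ℝ (Fin 2)) (t : ℝ) : ℝ :=
  ⨅ i, ‖x i t - xstar‖

theorem minDist_le {N : ℕ} (x : Fin N → ℝ → EuclideanSpace ℝ (Fin 2))
    (xstar : EuclideanSpace ℝ (Fin 2)) (t : ℝ) (i : Fin N) :
    minDist x xstar t ≤ ‖x i t - xstar‖ :=
  ciInf_le (Set.finite_range fun i => ‖x i t - xstar‖).bddBelow i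

theorem minDist_nonneg {N : ℕ} (x : Fin N → ℝ → EuclideanSpace ℝ (Fin 2))
    (xstar : EuclideanSpace ℝ (Fin 2)) (t : ℝ) : 0 ≤ minDist x xstar t :=
  Real.iInf_nonneg fun _ => norm_nonneg _

theorem exists_norm_eq_minDist {N : ℕ} [Nonempty (Fin N)]
    (x : Fin N → ℝ → EuclideanSpace ℝ (Fin 2)) (xstar : EuclideanSpace ℝ (Fin 2)) (t : ℝ) :
    ∃ i, ‖x i t - xstar‖ = minDist x xstar t :=
  exists_eq_ciInf_of_finite

theorem continuousOn_minDist {N : ℕ} [Nonempty (Fin N)]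
    {x : Fin N → ℝ → EuclideanSpace ℝ (Fin 2)} (xstar : EuclideanSpace ℝ (Fin 2))
    {s : Set ℝ} (hx : ∀ i, ContinuousOn (x i) s) : ContinuousOn (minDist x xstar) s := by
  have h : minDist x xstar =
      fun t => Finset.univ.inf' Finset.univ_nonempty fun i => ‖x i t - xstar‖ := by
    funext t
    rw [Finset.inf'_univ_eq_ciInf, minDist]
  rw [h]
  exact ContinuousOn.finset_inf'_apply _ fun i _ => ((hx i).sub continuousOn_const).norm

/-- Along a relaxation `x' = -α (x - c)`, the right slope of `‖x - p‖` is asymptotically at most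
`α (‖c - p‖ - ‖x - p‖)`. -/
theorem eventually_norm_sub_lt_of_hasDerivAt_relaxation
    {E : Type*} [NormedAddCommGroup E] [NormedSpace ℝ E] {x : ℝ → E} {c : E} (p : E)
    {α t L : ℝ} (hα : 0 < α) (hx : HasDerivAt x (-α • (x t - c)) t)
    (hL : α * (‖c - p‖ - ‖x t - p‖) < L) :
    ∀ᶠ z in 𝓝[>] t, ‖x z - p‖ < ‖x t - p‖ + (z - t) * L := by
  set ε := (L - α * (‖c - p‖ - ‖x t - p‖)) / 2 with hε
  have hε0 : 0 < ε := by linarith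
  have hR := (hasDerivAt_iff_isLittleO.1 hx).def hε0
  have hlt : ∀ᶠ z in 𝓝 t, z < t + α⁻¹ := gt_mem_nhds (by simpa using hα)
  filter_upwards [hR.filter_mono nhdsWithin_le_nhds, hlt.filter_mono nhdsWithin_le_nhds,
    self_mem_nhdsWithin] with z hz hz' (htz : t < z)
  have h0 : 0 < z - t := sub_pos.2 htz
  have h1 : α * (z - t) ≤ 1 := by
    have h : z - t ≤ α⁻¹ := by linarith
    calc α * (z - t) ≤ α * α⁻¹ := by gcongr
      _ = 1 := mul_inv_cancel₀ hα.ne'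
  have hαz : 0 ≤ α * (z - t) := by positivity
  rw [Real.norm_of_nonneg h0.le] at hz
  have hdecomp : x z - p = (x z - x t - (z - t) • (-α • (x t - c))) +
      ((1 - α * (z - t)) • (x t - p) + (α * (z - t)) • (c - p)) := by
    module
  have hle : ‖x z - p‖ ≤ ε * (z - t) +
      ((1 - α * (z - t)) * ‖x t - p‖ + α * (z - t) * ‖c - p‖) := by
    rw [hdecomp]
    refine (norm_add_le _ _).trans (add_le_add hz ((norm_add_le _ _).trans ?_))
    rw [norm_smul, norm_smul, Real.norm_of_nonneg (sub_nonneg.2 h1), Real.norm_of_nonneg hαz]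
  have hpos := mul_pos hε0 h0
  have hL' : L = α * (‖c - p‖ - ‖x t - p‖) + 2 * ε := by rw [hε]; ring
  rw [hL']
  linarith

/-- **Exponential convergence to the source under continuous Lloyd dynamics.**
If each sensor follows `x_i' = −α (x_i − c_i)` with continuous centroid trajectories, and
every nearest sensor's centroid satisfies `‖c_i(t) − x*‖ ≤ r·m(t)` with `r ∈ (0,1)`, then
the minimal sensor-to-source distance satisfies `m(t) ≤ e^{α(r−1)t} m(0)` and hence
converges to zero. -/
theorem lloyd_dynamics_exponential_convergence
    {N : ℕ} (hN : 1 ≤ N)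
    (xstar : EuclideanSpace ℝ (Fin 2))
    (α r : ℝ) (hα : 0 < α) (hr : r ∈ Set.Ioo (0 : ℝ) 1)
    (x c : Fin N → ℝ → EuclideanSpace ℝ (Fin 2))
    (hc : ∀ i, Continuous (c i))
    (hdyn : ∀ i, ∀ t, 0 ≤ t → HasDerivAt (x i) (-α • (x i t - c i t)) t)
    (hcent : ∀ t, 0 ≤ t → ∀ i, ‖x i t - xstar‖ = minDist x xstar t →
      ‖c i t - xstar‖ ≤ r * minDist x xstar t) :
    (∀ t, 0 ≤ t →
        minDist x xstar t ≤ Real.exp (α * (r - 1) * t) * minDist x xstar 0) ∧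
      Filter.Tendsto (minDist x xstar) Filter.atTop (𝓝 0) := by
  have : Nonempty (Fin N) := ⟨⟨0, hN⟩⟩
  have hbound : ∀ t, 0 ≤ t →
      minDist x xstar t ≤ Real.exp (α * (r - 1) * t) * minDist x xstar 0 := by
    intro T hT
    have hcont : ContinuousOn (minDist x xstar) (Set.Icc 0 T) :=
      continuousOn_minDist xstar fun i t ht => (hdyn i t ht.1).continuousAt.continuousWithinAt
    have h := le_gronwallBound_of_liminf_deriv_right_le (δ := minDist x xstar 0)
      (K := α * (r - 1)) (ε := 0) (f' := fun t => α * (r - 1) * minDist x xstar t) hcont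
      (fun t ht L hL => ?_) le_rfl (fun t _ => (add_zero _).ge) T ⟨hT, le_rfl⟩
    · rwa [gronwallBound_ε0, sub_zero, mul_comm] at h
    · obtain ⟨i, hi⟩ := exists_norm_eq_minDist x xstar t
      have hL' : α * (‖c i t - xstar‖ - ‖x i t - xstar‖) < L := by
        refine lt_of_le_of_lt ?_ hL
        rw [hi, mul_assoc]
        gcongr
        linarith [hcent t ht.1 i hi]
      refine Filter.Eventually.frequently ?_
      filter_upwards [eventually_norm_sub_lt_of_hasDerivAt_relaxation xstar hα
        (hdyn i t ht.1) hL', self_mem_nhdsWithin] with z hz (htz : t < z)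
      rw [inv_mul_lt_iff₀ (sub_pos.2 htz)]
      linarith [minDist_le x xstar z i]
  refine ⟨hbound, ?_⟩
  have hneg : α * (r - 1) < 0 := mul_neg_of_pos_of_neg hα (sub_neg.2 hr.2)
  have hexp : Filter.Tendsto (fun t => Real.exp (α * (r - 1) * t) * minDist x xstar 0)
      Filter.atTop (𝓝 0) := by
    simpa using (Real.tendsto_exp_atBot.comp
      (Filter.tendsto_id.const_mul_atTop_of_neg hneg)).mul_const (minDist x xstar 0)
  refine tendsto_of_tendsto_of_tendsto_of_le_of_le' tendsto_const_nhds hexp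
    (Filter.Eventually.of_forall (minDist_nonneg x xstar)) ?_
  filter_upwards [Filter.eventually_ge_atTop 0] with t ht using hbound t ht
end

section
/- Let x*, c ∈ ℝ², α > 0, r ∈ (0,1), and let x : I → ℝ² be differentiable at t ∈ I with x(t) ≠ x* and x'(t) = −α·(x(t) − c). If ‖c − x*‖ ≤ r·‖x(t) − x*‖, then the function s ↦ ‖x(s) − x*‖ is differentiable at t and its derivative satisfies d/ds ‖x(s) − x*‖ |_{s=t} ≤ α·(r − 1)·‖x(t) − x*‖. Equivalently, the inner product satisfies ⟨x(t) − x*, x(t) − c⟩ ≥ (1 − r)·‖x(t) − x*‖². -/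
open scoped RealInnerProductSpace

/-- The norm of a differentiable curve is differentiable wherever the curve does not vanish. -/
theorem HasDerivAt.norm_of_ne_zero {F : Type*} [NormedAddCommGroup F] [InnerProductSpace ℝ F]
    {f : ℝ → F} {f' : F} {t : ℝ} (hf : HasDerivAt f f' t) (h0 : f t ≠ 0) :
    HasDerivAt (fun s => ‖f s‖) (⟪f t, f'⟫ / ‖f t‖) t := by
  have hpos : 0 < ‖f t‖ := norm_pos_iff.mpr h0
  have h := hf.norm_sq.sqrt (pow_ne_zero 2 hpos.ne')
  simp only [Real.sqrt_sq (norm_nonneg _)] at h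
  convert h using 1
  field_simp

/-- If `‖w‖ ≤ r ‖v‖`, then `(1 - r) ‖v‖² ≤ ⟪v, v - w⟫`. -/
theorem one_sub_mul_norm_sq_le_inner_sub {F : Type*} [NormedAddCommGroup F]
    [InnerProductSpace ℝ F] {v w : F} {r : ℝ} (h : ‖w‖ ≤ r * ‖v‖) :
    (1 - r) * ‖v‖ ^ 2 ≤ ⟪v, v - w⟫ := by
  rw [inner_sub_right, real_inner_self_eq_norm_sq]
  nlinarith [real_inner_le_norm v w, mul_le_mul_of_nonneg_left h (norm_nonneg v)]

/-- **Pointwise descent estimate for a single sensor under continuous Lloyd dynamics.**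
If `x' (t) = −α (x(t) − c)` with `x(t) ≠ x*` and `‖c − x*‖ ≤ r ‖x(t) − x*‖`, then
`s ↦ ‖x(s) − x*‖` is differentiable at `t` with derivative at most `α (r−1) ‖x(t) − x*‖`;
equivalently `⟪x(t) − x*, x(t) − c⟫ ≥ (1 − r) ‖x(t) − x*‖²`. -/
theorem lloyd_pointwise_descent
    (xstar c : EuclideanSpace ℝ (Fin 2)) (α r : ℝ) (hα : 0 < α)
    (hr : r ∈ Set.Ioo (0 : ℝ) 1)
    (x : ℝ → EuclideanSpace ℝ (Fin 2)) (t : ℝ)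
    (hx : HasDerivAt x (-α • (x t - c)) t)
    (hne : x t ≠ xstar)
    (hc : ‖c - xstar‖ ≤ r * ‖x t - xstar‖) :
    (∃ d : ℝ, HasDerivAt (fun s => ‖x s - xstar‖) d t ∧
        d ≤ α * (r - 1) * ‖x t - xstar‖) ∧
      (1 - r) * ‖x t - xstar‖ ^ 2 ≤ ⟪x t - xstar, x t - c⟫ := by
  have h_inner : (1 - r) * ‖x t - xstar‖ ^ 2 ≤ ⟪x t - xstar, x t - c⟫ := by
    simpa using one_sub_mul_norm_sq_le_inner_sub hc
  have hpos : 0 < ‖x t - xstar‖ := norm_pos_iff.mpr (sub_ne_zero.mpr hne)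
  refine ⟨⟨_, (hx.sub_const xstar).norm_of_ne_zero (sub_ne_zero.mpr hne), ?_⟩, h_inner⟩
  rw [div_le_iff₀ hpos, real_inner_smul_right]
  nlinarith [mul_le_mul_of_nonneg_left h_inner hα.le]
end

section
/- Let V ⊆ ℝ² be a convex set, let x*, q_1, q_2 ∈ ℝ² with q_1 ≠ q_2 and x* not on the line L through q_1 and q_2, and suppose the closed triangle with vertices q_1, q_2, x* is contained in V. Let s > 0 with dist(x*, L) ≥ s, and let θ be the angle between the vectors q_1 − x* and q_2 − x*. Then the closed circular sector centered at x* of radius s bounded by the rays from x* through q_1 and q_2 is contained in V, and consequently the Lebesgue area of V ∩ closedBall(x*, s) is at least (θ/2)·s². -/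
open MeasureTheory

open InnerProductGeometry in
theorem Complex.exists_linearIsometryEquiv_polar {z w : ℂ} (hz : z ≠ 0) (hw : w ≠ 0) :
    ∃ e : ℂ ≃ₗᵢ[ℝ] ℂ, e ‖z‖ = z ∧ e (‖w‖ * exp (angle z w * I)) = w := by
  have hwz : w / z ≠ 0 := div_ne_zero hw hz
  have hzn : (‖z‖ : ℂ) ≠ 0 := by simpa using hz
  have hz' := norm_mul_exp_arg_mul_I z
  have hdiv := norm_mul_exp_arg_mul_I (w / z)
  have hw' : exp (arg z * I) * (‖w‖ * exp (arg (w / z) * I)) = w := by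
    calc exp (arg z * I) * (‖w‖ * exp (arg (w / z) * I))
        = (‖z‖ * exp (arg z * I)) * (‖w / z‖ * exp (arg (w / z) * I)) := by
          rw [norm_div]; push_cast; field_simp
      _ = w := by rw [hz', hdiv]; field_simp
  rw [angle_comm, angle_eq_abs_arg hw hz]
  rcases le_total 0 (arg (w / z)) with h | h
  · refine ⟨rotation (Circle.exp (arg z)), ?_, ?_⟩
    · rw [rotation_apply, Circle.coe_exp, mul_comm, hz']
    · rw [rotation_apply, Circle.coe_exp, abs_of_nonneg h, hw']
  · refine ⟨conjLIE.trans (rotation (Circle.exp (arg z))), ?_, ?_⟩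
    · rw [LinearIsometryEquiv.trans_apply, rotation_apply, Circle.coe_exp, conjLIE_apply,
        conj_ofReal, mul_comm, hz']
    · rw [LinearIsometryEquiv.trans_apply, rotation_apply, Circle.coe_exp, conjLIE_apply,
        abs_of_nonpos h, map_mul, conj_ofReal, ← exp_conj, map_mul, conj_ofReal, conj_I]
      simpa using hw'

/-- The area of the open polar rectangle of radius `s` and angle `θ` bounds from below the measure
of any set containing it. -/
theorem Complex.ofReal_le_volume_of_polar_mem {A : Set ℂ} {s θ : ℝ} (hs : 0 ≤ s) (hθ : θ ≤ Real.pi)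
    (hA : ∀ r ∈ Set.Ioo 0 s, ∀ φ ∈ Set.Ioo 0 θ, (r : ℂ) * exp (φ * I) ∈ A) :
    ENNReal.ofReal (θ / 2 * s ^ 2) ≤ volume A := by
  have hint : ∫⁻ r in Set.Ioo 0 s, ENNReal.ofReal r = ENNReal.ofReal (s ^ 2 / 2) := by
    rw [← ofReal_integral_eq_lintegral_ofReal]
    · rw [← integral_Ioc_eq_integral_Ioo, ← intervalIntegral.integral_of_le hs, integral_id]
      simp
    · exact (continuous_id.integrableOn_Icc (a := 0) (b := s)).mono_set Set.Ioo_subset_Icc_self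
    · filter_upwards [ae_restrict_mem measurableSet_Ioo] with r hr using hr.1.le
  have hsub : Set.Ioo 0 s ×ˢ Set.Ioo 0 θ ⊆ polarCoord.target := by
    rintro ⟨r, φ⟩ ⟨hr, hφ⟩
    exact ⟨hr.1, by linarith [hφ.1, Real.pi_pos], hφ.2.trans_le hθ⟩
  calc ENNReal.ofReal (θ / 2 * s ^ 2)
      = ∫⁻ p in Set.Ioo 0 s ×ˢ Set.Ioo 0 θ, ENNReal.ofReal p.1 := by
        rw [Measure.volume_eq_prod, ← Measure.prod_restrict,
          lintegral_prod _ (by fun_prop)]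
        simp only [lintegral_const, MeasurableSet.univ, Measure.restrict_apply, Set.univ_inter,
          Real.volume_Ioo, sub_zero]
        rw [lintegral_mul_const _ (by fun_prop), hint, ← ENNReal.ofReal_mul (by positivity)]
        congr 1
        ring
    _ ≤ ∫⁻ p in Set.Ioo 0 s ×ˢ Set.Ioo 0 θ,
          ENNReal.ofReal p.1 • A.indicator 1 (Complex.polarCoord.symm p) := by
        refine setLIntegral_mono' (measurableSet_Ioo.prod measurableSet_Ioo) ?_
        rintro ⟨r, φ⟩ ⟨hr, hφ⟩
        have hmem : Complex.polarCoord.symm (r, φ) ∈ A := by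
          rw [Complex.polarCoord_symm_apply]
          simpa [exp_mul_I] using hA r hr φ hφ
        rw [Set.indicator_of_mem hmem]
        simp
    _ ≤ ∫⁻ p in polarCoord.target,
          ENNReal.ofReal p.1 • A.indicator 1 (Complex.polarCoord.symm p) :=
        lintegral_mono_set hsub
    _ = ∫⁻ p, A.indicator 1 p := Complex.lintegral_comp_polarCoord_symm _
    _ ≤ volume A := lintegral_indicator_one_le A

open InnerProductGeometry in
theorem ofReal_angle_le_volume_sector {u v : EuclideanSpace ℝ (Fin 2)} (hu : u ≠ 0) (hv : v ≠ 0)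
    (huv : Real.sin (angle u v) ≠ 0) {s : ℝ} (hs : 0 ≤ s) (x : EuclideanSpace ℝ (Fin 2)) :
    ENNReal.ofReal (angle u v / 2 * s ^ 2) ≤
      volume {p | ∃ a b : ℝ, 0 ≤ a ∧ 0 ≤ b ∧ p = x + a • u + b • v ∧ dist p x ≤ s} := by
  obtain ⟨e, heu, hev⟩ : ∃ e : ℂ ≃ₗᵢ[ℝ] EuclideanSpace ℝ (Fin 2),
      e ‖u‖ = u ∧ e (‖v‖ * Complex.exp (angle u v * Complex.I)) = v := by
    set Ψ := Complex.orthonormalBasisOneI.repr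
    obtain ⟨e, h₁, h₂⟩ := Complex.exists_linearIsometryEquiv_polar
      (z := Ψ.symm u) (w := Ψ.symm v) (by simpa using hu) (by simpa using hv)
    have hang : angle (Ψ.symm u) (Ψ.symm v) = angle u v :=
      Ψ.symm.toLinearIsometry.angle_map u v
    rw [Ψ.symm.norm_map] at h₁ h₂
    rw [hang] at h₂
    exact ⟨e.trans Ψ, by simp [h₁], by rw [LinearIsometryEquiv.trans_apply, h₂]; simp⟩
  set θ := angle u v
  have hθ : θ ≤ Real.pi := angle_le_pi u v
  have hsin : 0 < Real.sin θ := huv.symm.lt_of_le (sin_angle_nonneg u v)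
  have hmp : MeasurePreserving (fun p : ℂ => x + e p) :=
    (measurePreserving_add_left volume x).comp e.measurePreserving
  have hemb : MeasurableEmbedding (fun p : ℂ => x + e p) :=
    (measurableEmbedding_addLeft x).comp e.toHomeomorph.measurableEmbedding
  rw [← hmp.measure_preimage_emb hemb]
  refine Complex.ofReal_le_volume_of_polar_mem hs hθ fun r hr φ hφ => ?_
  have hsin₁ : 0 ≤ Real.sin (θ - φ) :=
    Real.sin_nonneg_of_nonneg_of_le_pi (by linarith [hφ.2]) (by linarith [hφ.1])
  have hsin₂ : 0 ≤ Real.sin φ :=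
    Real.sin_nonneg_of_nonneg_of_le_pi hφ.1.le (by linarith [hφ.2])
  have hu' : ‖u‖ ≠ 0 := norm_ne_zero_iff.2 hu
  have hv' : ‖v‖ ≠ 0 := norm_ne_zero_iff.2 hv
  have hr₀ := hr.1
  refine ⟨r * Real.sin (θ - φ) / (Real.sin θ * ‖u‖), r * Real.sin φ / (Real.sin θ * ‖v‖),
    by positivity, by positivity, ?_, ?_⟩
  · have hdecomp : (r : ℂ) * Complex.exp (φ * Complex.I) =
        (r * Real.sin (θ - φ) / (Real.sin θ * ‖u‖) : ℝ) • (‖u‖ : ℂ) +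
          (r * Real.sin φ / (Real.sin θ * ‖v‖) : ℝ) • (‖v‖ * Complex.exp (θ * Complex.I)) := by
      apply Complex.ext
      · simp only [Complex.add_re, Complex.smul_re, Complex.re_ofReal_mul, Complex.ofReal_re,
          Complex.exp_ofReal_mul_I_re, smul_eq_mul, Real.sin_sub]
        field_simp
        ring
      · simp only [Complex.add_im, Complex.smul_im, Complex.im_ofReal_mul, Complex.ofReal_im,
          Complex.exp_ofReal_mul_I_im, smul_eq_mul]
        field_simp
        ring
    simp only [hdecomp]
    rw [map_add, map_smul, map_smul, heu, hev, add_assoc]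
  · simpa [Complex.norm_exp_ofReal_mul_I, abs_of_pos hr₀] using hr.2.le

/-- Every point of the cone at `x` spanned by `q₁ - x` and `q₂ - x` that is no farther from `x`
than the line `q₁ q₂` lies in the triangle. -/
theorem mem_convexHull_of_norm_le_infDist_line {E : Type*} [NormedAddCommGroup E]
    [NormedSpace ℝ E] {x q₁ q₂ : E} {a b : ℝ} (ha : 0 ≤ a) (hb : 0 ≤ b)
    (hpos : 0 < Metric.infDist x (affineSpan ℝ ({q₁, q₂} : Set E)))
    (h : ‖a • (q₁ - x) + b • (q₂ - x)‖ ≤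
      Metric.infDist x (affineSpan ℝ ({q₁, q₂} : Set E))) :
    x + a • (q₁ - x) + b • (q₂ - x) ∈ convexHull ℝ ({q₁, q₂, x} : Set E) := by
  have hab : a + b ≤ 1 := by
    by_contra! hlt
    have ht : 0 < a + b := by linarith
    have hm : AffineMap.lineMap q₁ q₂ (b / (a + b)) ∈ affineSpan ℝ ({q₁, q₂} : Set E) :=
      AffineMap.lineMap_mem_affineSpan_pair _ _ _
    have hle := Metric.infDist_le_dist_of_mem (x := x) hm
    have heq : AffineMap.lineMap q₁ q₂ (b / (a + b)) - x =
        (a + b)⁻¹ • (a • (q₁ - x) + b • (q₂ - x)) := by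
      rw [AffineMap.lineMap_apply_module]
      match_scalars <;> field_simp <;> ring
    rw [dist_comm, dist_eq_norm, heq, norm_smul, norm_inv, Real.norm_of_nonneg ht.le,
      inv_mul_eq_div, le_div_iff₀ ht] at hle
    nlinarith
  have hcomb := (convex_convexHull ℝ ({q₁, q₂, x} : Set E)).sum_mem
    (t := Finset.univ) (w := ![a, b, 1 - a - b]) (z := ![q₁, q₂, x])
    (by simp [Fin.forall_fin_succ, ha, hb]; linarith)
    (by simp [Fin.sum_univ_three])
    (by
      intro i _
      apply subset_convexHull
      fin_cases i <;> simp)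
  convert hcomb using 1
  simp only [Fin.sum_univ_three, Matrix.cons_val]
  module

/-- **Sector lower bound for the area of a convex set containing a triangle.**
If the closed triangle `q₁ q₂ x*` lies in a convex set `V`, `x*` is not on the line `L`
through `q₁` and `q₂`, and `dist(x*, L) ≥ s > 0`, then the closed circular sector at `x*`
of radius `s` between the rays toward `q₁` and `q₂` is contained in `V`; consequently the
area of `V ∩ closedBall(x*, s)` is at least `(θ/2)·s²`, where `θ` is the angle
`∠(q₁, x*, q₂)`. -/
theorem sector_subset_convex_and_area_lower_bound
    (V : Set (EuclideanSpace ℝ (Fin 2))) (hV : Convex ℝ V)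
    (xstar q₁ q₂ : EuclideanSpace ℝ (Fin 2))
    (hq : q₁ ≠ q₂)
    (hline : xstar ∉ affineSpan ℝ ({q₁, q₂} : Set (EuclideanSpace ℝ (Fin 2))))
    (htri : convexHull ℝ ({q₁, q₂, xstar} : Set (EuclideanSpace ℝ (Fin 2))) ⊆ V)
    (s : ℝ) (hs : 0 < s)
    (hdist : s ≤ Metric.infDist xstar
      ((affineSpan ℝ ({q₁, q₂} : Set (EuclideanSpace ℝ (Fin 2)))) :
        Set (EuclideanSpace ℝ (Fin 2)))) :
    {p : EuclideanSpace ℝ (Fin 2) | ∃ a b : ℝ, 0 ≤ a ∧ 0 ≤ b ∧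
        p = xstar + a • (q₁ - xstar) + b • (q₂ - xstar) ∧ dist p xstar ≤ s} ⊆ V ∧
      (EuclideanGeometry.angle q₁ xstar q₂ / 2) * s ^ 2 ≤
        (volume (V ∩ Metric.closedBall xstar s)).toReal := by
  have hq₁ := left_mem_affineSpan_pair ℝ q₁ q₂
  have hq₂ := right_mem_affineSpan_pair ℝ q₁ q₂
  have hsector : {p : EuclideanSpace ℝ (Fin 2) | ∃ a b : ℝ, 0 ≤ a ∧ 0 ≤ b ∧
      p = xstar + a • (q₁ - xstar) + b • (q₂ - xstar) ∧ dist p xstar ≤ s} ⊆ V := by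
    rintro p ⟨a, b, ha, hb, rfl, hp⟩
    refine htri (mem_convexHull_of_norm_le_infDist_line ha hb (hs.trans_le hdist) ?_)
    rw [dist_eq_norm, add_assoc, add_sub_cancel_left] at hp
    exact hp.trans hdist
  refine ⟨hsector, ?_⟩
  have hu : q₁ - xstar ≠ 0 := sub_ne_zero.2 fun h => hline (h ▸ hq₁)
  have hv : q₂ - xstar ≠ 0 := sub_ne_zero.2 fun h => hline (h ▸ hq₂)
  have hsin : Real.sin (EuclideanGeometry.angle q₁ xstar q₂) ≠ 0 := fun h =>
    hline <| (EuclideanGeometry.collinear_of_sin_eq_zero h).mem_affineSpan_of_mem_of_ne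
      (by simp) (by simp) (by simp) hq
  have hfin : volume (V ∩ Metric.closedBall xstar s) ≠ ⊤ :=
    measure_ne_top_of_subset Set.inter_subset_right measure_closedBall_lt_top.ne
  refine (ENNReal.ofReal_le_iff_le_toReal hfin).1 ?_
  refine (ofReal_angle_le_volume_sector hu hv hsin hs.le xstar).trans (measure_mono ?_)
  exact Set.subset_inter hsector fun p ⟨_, _, _, _, _, hp⟩ => hp
end

section
/- For every a ≥ 0 and every θ ∈ [0, π/3], arctan(a·tan θ) ≤ 2·a·θ. -/
theorem Real.arctan_le_self_of_nonneg {x : ℝ} (hx : 0 ≤ x) : Real.arctan x ≤ x := by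
  simpa only [Real.tan_arctan] using
    Real.le_tan (Real.arctan_nonneg.2 hx) (Real.arctan_lt_pi_div_two x)

theorem Real.tan_le_two_mul {θ : ℝ} (hθ : θ ∈ Set.Icc 0 (Real.pi / 3)) :
    Real.tan θ ≤ 2 * θ := by
  obtain ⟨h0, h1⟩ := hθ
  have hpi := Real.pi_pos
  have hcos : 1 / 2 ≤ Real.cos θ := by
    rw [← Real.cos_pi_div_three]
    exact Real.cos_le_cos_of_nonneg_of_le_pi h0 (by linarith) h1
  have hsin : Real.sin (θ / 2) ≤ θ / 2 := Real.sin_le (by linarith)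
  have hhalf : 0 ≤ Real.cos (θ / 2) :=
    Real.cos_nonneg_of_mem_Icc ⟨by linarith, by linarith⟩
  have hsin_two : Real.sin θ = 2 * Real.sin (θ / 2) * Real.cos (θ / 2) := by
    rw [← Real.sin_two_mul, mul_div_cancel₀ θ two_ne_zero]
  have hcos_le : Real.cos (θ / 2) ≤ 2 * Real.cos θ := by
    linarith [Real.cos_le_one (θ / 2)]
  rw [Real.tan_eq_sin_div_cos, div_le_iff₀ (by linarith), hsin_two]
  calc 2 * Real.sin (θ / 2) * Real.cos (θ / 2) ≤ θ * Real.cos (θ / 2) :=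
        mul_le_mul_of_nonneg_right (by linarith) hhalf
    _ ≤ θ * (2 * Real.cos θ) := mul_le_mul_of_nonneg_left hcos_le h0
    _ = 2 * θ * Real.cos θ := by ring

/-- **Arctangent–tangent angle bound.** For every `a ≥ 0` and `θ ∈ [0, π/3]`,
`arctan(a · tan θ) ≤ 2·a·θ`. -/
theorem arctan_mul_tan_le_two_mul
    (a : ℝ) (ha : 0 ≤ a) (θ : ℝ) (hθ : θ ∈ Set.Icc 0 (Real.pi / 3)) :
    Real.arctan (a * Real.tan θ) ≤ 2 * a * θ := by
  have htan : 0 ≤ Real.tan θ :=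
    Real.tan_nonneg_of_nonneg_of_le_pi_div_two hθ.1 (by linarith [hθ.2, Real.pi_pos])
  calc Real.arctan (a * Real.tan θ) ≤ a * Real.tan θ :=
        Real.arctan_le_self_of_nonneg (mul_nonneg ha htan)
    _ ≤ a * (2 * θ) := mul_le_mul_of_nonneg_left (Real.tan_le_two_mul hθ) ha
    _ = 2 * a * θ := by ring
end
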